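/- Suppose m + t + 1 ≤ k and let Y = {V_1, …, V_{m+2}} ∈ 𝕐. Then the set C_Y = {(V_i, Y \ {V_i}) : i = 1, …, m+2} consists of m+2 distinct vertices of L and is a clique of size m+2 in the complement of the square L². -/

import Mathlib

/-- The square of a graph `G`: same vertex set, two distinct vertices adjacent iff
they are adjacent in `G` or have a common neighbor in `G`. -/
def SimpleGraph.square {V : Type*} (G : SimpleGraph V) : SimpleGraph V where
  Adj u v := u ≠ v ∧ (G.Adj u v ∨ ∃ w, G.Adj u w ∧ G.Adj w v)
  symm := by
    constructor
    rintro u v ⟨hne, h | ⟨w, hw1, hw2⟩⟩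
    · exact ⟨hne.symm, Or.inl h.symm⟩
    · exact ⟨hne.symm, Or.inr ⟨w, hw2.symm, hw1.symm⟩⟩
  loopless := ⟨fun v h => h.1 rfl⟩

/-- The vertices of the caching line graph: pairs `(V, X)` with `V ∈ 𝕍`, `X ∈ 𝕏` and
`V ⊄ Σ_{V_i ∈ X} V_i`. -/
def CacheVtx (F : Type*) [Field F] (k m t : ℕ) (W : Submodule F (Fin k → F)) : Type _ :=
  {p : Submodule F (Fin k → F) × Finset (Submodule F (Fin k → F)) //
    (Module.finrank F ↥p.1 = t ∧ W ≤ p.1) ∧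
    (p.2.card = m + 1 ∧ (∀ V ∈ p.2, Module.finrank F ↥V = t ∧ W ≤ V) ∧
      Module.finrank F ↥(p.2.sup id) = m + t) ∧
    ¬ p.1 ≤ p.2.sup id}

/-- The caching line graph `L`: two distinct vertices `(V1, X1)`, `(V2, X2)` are adjacent
iff exactly one of `V1 = V2`, `X1 = X2` holds. -/
def cachingLineGraph (F : Type*) [Field F] (k m t : ℕ) (W : Submodule F (Fin k → F)) :
    SimpleGraph (CacheVtx F k m t W) where
  Adj x y := Xor' (x.val.1 = y.val.1) (x.val.2 = y.val.2)
  symm := by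
    constructor
    rintro x y (⟨h1, h2⟩ | ⟨h1, h2⟩)
    · exact Or.inl ⟨h1.symm, fun h => h2 h.symm⟩
    · exact Or.inr ⟨h1.symm, fun h => h2 h.symm⟩
  loopless := ⟨by rintro x (⟨h1, h2⟩ | ⟨h1, h2⟩) <;> exact h2 rfl⟩

theorem aux_step {F : Type*} [Field F] {k t : ℕ} (W A V : Submodule F (Fin k → F))
    (ht : 1 ≤ t) (hW : Module.finrank F ↥W = t - 1)
    (hA : W ≤ A) (hV : Module.finrank F ↥V = t ∧ W ≤ V) :
    Module.finrank F ↥(V ⊔ A) ≤ Module.finrank F ↥A + 1 := by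
  have h1 := Submodule.finrank_sup_add_finrank_inf_eq V A
  have h2 : Module.finrank F ↥W ≤ Module.finrank F ↥(V ⊓ A) :=
    Submodule.finrank_mono (le_inf hV.2 hA)
  have := hV.1
  omega

theorem aux_le {F : Type*} [Field F] {k t : ℕ} (W : Submodule F (Fin k → F))
    (ht : 1 ≤ t) (hW : Module.finrank F ↥W = t - 1)
    (S : Finset (Submodule F (Fin k → F)))
    (hS : ∀ V ∈ S, Module.finrank F ↥V = t ∧ W ≤ V) :
    Module.finrank F ↥(W ⊔ S.sup id) ≤ t - 1 + S.card := by
  classical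
  induction S using Finset.induction_on with
  | empty => rw [Finset.sup_empty, sup_bot_eq, hW]; omega
  | insert V S hVS ih =>
    have h1 := ih (fun U hU => hS U (Finset.mem_insert_of_mem hU))
    have h2 := aux_step W (W ⊔ S.sup id) V ht hW le_sup_left
      (hS V (Finset.mem_insert_self V S))
    rw [Finset.sup_insert, Finset.card_insert_of_notMem hVS, id, sup_left_comm]
    omega

/-- For `Y = {V_1, …, V_{m+2}} ∈ 𝕐`, the set `C_Y = {(V_i, Y \ {V_i})}` consists of `m+2`
distinct vertices of `L` and is a clique of size `m+2` in the complement of the square `L²`. -/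
theorem stmt11 (q k m t : ℕ) (F : Type*) [Field F] [Fintype F]
    [DecidableEq (Submodule F (Fin k → F))]
    (hq : Fintype.card F = q)
    (hm : 1 ≤ m) (ht : 1 ≤ t) (hk : m + t + 1 ≤ k)
    (W : Submodule F (Fin k → F)) (hW : Module.finrank F ↥W = t - 1)
    (Y : Finset (Submodule F (Fin k → F)))
    (hYcard : Y.card = m + 2)
    (hYmem : ∀ V ∈ Y, Module.finrank F ↥V = t ∧ W ≤ V)
    (hYdim : Module.finrank F ↥(Y.sup id) = m + t + 1) :
    (((cachingLineGraph F k m t W).square)ᶜ).IsClique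
        {c : CacheVtx F k m t W | ∃ V ∈ Y, c.val = (V, Y.erase V)} ∧
      Set.ncard {c : CacheVtx F k m t W | ∃ V ∈ Y, c.val = (V, Y.erase V)} = m + 2 := by
  have key : ∀ V ∈ Y, (Module.finrank F ↥V = t ∧ W ≤ V) ∧
    ((Y.erase V).card = m + 1 ∧ (∀ U ∈ Y.erase V, Module.finrank F ↥U = t ∧ W ≤ U) ∧
      Module.finrank F ↥((Y.erase V).sup id) = m + t) ∧ ¬ V ≤ (Y.erase V).sup id := by
    intro V hV
    have hc : (Y.erase V).card = m + 1 := by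
      rw [Finset.card_erase_of_mem hV]; omega
    have hmem : ∀ U ∈ Y.erase V, Module.finrank F ↥U = t ∧ W ≤ U :=
      fun U hU => hYmem U (Finset.mem_of_mem_erase hU)
    obtain ⟨U, hU⟩ : (Y.erase V).Nonempty := Finset.card_pos.1 (by omega)
    have hWle : W ≤ (Y.erase V).sup id :=
      (hmem U hU).2.trans (Finset.le_sup (f := id) hU)
    have hsup : Y.sup id = V ⊔ (Y.erase V).sup id := by
      conv_lhs => rw [← Finset.insert_erase hV]
      rw [Finset.sup_insert, id]
    have h1 := aux_step W _ V ht hW hWle (hYmem V hV)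
    rw [← hsup, hYdim] at h1
    have h2 := aux_le W ht hW _ hmem
    rw [sup_eq_right.2 hWle, hc] at h2
    have h3 : Module.finrank F ↥((Y.erase V).sup id) = m + t := by omega
    refine ⟨hYmem V hV, ⟨hc, hmem, h3⟩, fun hle => ?_⟩
    rw [hsup, sup_eq_right.2 hle] at hYdim
    omega
  refine ⟨?_, ?_⟩
  · rintro a ⟨V, hV, ha⟩ b ⟨U, hU, hb⟩ hab
    rw [SimpleGraph.compl_adj]
    refine ⟨hab, ?_⟩
    have hVU : V ≠ U := by
      rintro rfl
      exact hab (Subtype.ext (ha.trans hb.symm))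
    have hE : Y.erase V ≠ Y.erase U := fun h =>
      Finset.notMem_erase V Y (h ▸ Finset.mem_erase.2 ⟨hVU, hV⟩)
    rintro ⟨-, h | ⟨w, h1, h2⟩⟩
    · change Xor' (a.val.1 = b.val.1) (a.val.2 = b.val.2) at h
      rw [ha, hb] at h
      rcases h with ⟨h, -⟩ | ⟨h, -⟩
      · exact hVU h
      · exact hE h
    · change Xor' (a.val.1 = w.val.1) (a.val.2 = w.val.2) at h1
      change Xor' (w.val.1 = b.val.1) (w.val.2 = b.val.2) at h2
      rw [ha] at h1
      rw [hb] at h2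
      have hn : w.val.1 ∉ w.val.2 := fun hh => w.property.2.2 (Finset.le_sup (f := id) hh)
      rcases h1 with ⟨h1, -⟩ | ⟨h1, -⟩ <;> rcases h2 with ⟨h2, -⟩ | ⟨h2, -⟩
      · exact hVU (h1.trans h2)
      · apply hn
        rw [h2, ← h1]
        exact Finset.mem_erase.2 ⟨hVU, hV⟩
      · apply hn
        rw [h2, ← h1]
        exact Finset.mem_erase.2 ⟨hVU.symm, hU⟩
      · exact hE (h1.trans h2)
  · rw [← hYcard, ← Set.ncard_coe_finset Y]
    symm
    refine Set.ncard_congr (fun V hV => (⟨(V, Y.erase V), key V hV⟩ : CacheVtx F k m t W))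
      (fun V hV => ⟨V, hV, rfl⟩) ?_ ?_
    · intro V U hV hU h
      exact congrArg (fun c : CacheVtx F k m t W => c.val.1) h
    · rintro c ⟨V, hV, hc⟩
      exact ⟨V, hV, Subtype.ext hc.symm⟩
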